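/- Let f : B(0,4R) → ℝ be α-smooth convex and h : B(0,4R) → ℝ convex with ‖h-f‖_∞ ≤ ε, ε ≤ αR², r ≤ R. Define h_r(x) = 𝔼[h(x+rU)] with U uniform on B(0,1). Then h_r is differentiable on B(0,R) and for all x, y ∈ B(0,R), ‖∇h_r(x) - ∇h_r(y)‖ ≤ (4√(αεd)/r + 3α√d)·‖x - y‖. -/

import Mathlib

open Metric MeasureTheory
open scoped RealInnerProductSpace

lemma Real.Gamma_add_half_le {s : ℝ} (hs : 0 < s) :
    Real.Gamma (s + 1 / 2) ≤ Real.sqrt s * Real.Gamma s := by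
  have hG := Real.Gamma_pos_of_pos hs
  have h := Real.Gamma_mul_add_mul_le_rpow_Gamma_mul_rpow_Gamma hs (by linarith : 0 < s + 1)
    (by norm_num : (0 : ℝ) < 1 / 2) (by norm_num : (0 : ℝ) < 1 / 2) (by norm_num)
  have e : 1 / 2 * s + 1 / 2 * (s + 1) = s + 1 / 2 := by ring
  rw [e, Real.Gamma_add_one hs.ne', ← Real.sqrt_eq_rpow, ← Real.sqrt_eq_rpow,
    Real.sqrt_mul hs.le] at h
  calc _ ≤ _ := h
    _ = Real.sqrt s * (Real.sqrt (Real.Gamma s) * Real.sqrt (Real.Gamma s)) := by ring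
    _ = _ := by rw [Real.mul_self_sqrt hG.le]

lemma volume_unit_ball_le_succ (n : ℕ) :
    volume (closedBall (0 : EuclideanSpace ℝ (Fin n)) 1) ≤
      ENNReal.ofReal (Real.sqrt (n + 1)) *
        volume (closedBall (0 : EuclideanSpace ℝ (Fin (n + 1))) 1) := by
  have h1 : volume (closedBall (0 : EuclideanSpace ℝ (Fin n)) 1) =
      ENNReal.ofReal (Real.sqrt Real.pi ^ n / Real.Gamma (n / 2 + 1)) := by
    rcases n with _ | n
    · have : closedBall (0 : EuclideanSpace ℝ (Fin 0)) 1 = Set.univ := by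
        ext x; simp [Subsingleton.elim x 0]
      rw [this, ← Set.preimage_univ (f := WithLp.ofLp),
        (PiLp.volume_preserving_ofLp (Fin 0)).measure_preimage
          MeasurableSet.univ.nullMeasurableSet, volume_pi, Measure.pi_univ]
      simp
    · rw [EuclideanSpace.volume_closedBall]; simp
  rw [h1, EuclideanSpace.volume_closedBall, ← ENNReal.ofReal_pow zero_le_one,
    ← ENNReal.ofReal_mul (by positivity), ← ENNReal.ofReal_mul (by positivity)]
  refine ENNReal.ofReal_le_ofReal ?_
  simp only [Fintype.card_fin, one_pow, one_mul]
  have hs : (0 : ℝ) < n / 2 + 1 := by positivity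
  have hG := Real.Gamma_pos_of_pos hs
  have hG' : 0 < Real.Gamma (((n + 1 : ℕ) : ℝ) / 2 + 1) := Real.Gamma_pos_of_pos (by positivity)
  have h := Real.Gamma_add_half_le hs
  have e : (n : ℝ) / 2 + 1 + 1 / 2 = ((n + 1 : ℕ) : ℝ) / 2 + 1 := by push_cast; ring
  rw [e] at h
  have hle : Real.sqrt ((n : ℝ) / 2 + 1) ≤ Real.sqrt (n + 1) * Real.sqrt Real.pi := by
    rw [← Real.sqrt_mul (by positivity)]
    apply Real.sqrt_le_sqrt
    nlinarith [Real.pi_gt_three, (Nat.cast_nonneg n : (0 : ℝ) ≤ n)]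
  rw [← mul_div_assoc, div_le_div_iff₀ hG hG', pow_succ]
  have hp : 0 ≤ Real.sqrt Real.pi ^ n := by positivity
  calc _ ≤ Real.sqrt Real.pi ^ n * (Real.sqrt (n / 2 + 1) * Real.Gamma (n / 2 + 1)) := by gcongr
    _ ≤ Real.sqrt Real.pi ^ n *
        ((Real.sqrt (n + 1) * Real.sqrt Real.pi) * Real.Gamma (n / 2 + 1)) := by gcongr
    _ = _ := by ring

lemma volume_shift_interval_diff_le (s δ : ℝ) (hδ : 0 ≤ δ) :
    volume {t : ℝ | t ^ 2 + s ≤ 1 ∧ 1 < (t - δ) ^ 2 + s} ≤ ENNReal.ofReal δ := by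
  have hsub : {t : ℝ | t ^ 2 + s ≤ 1 ∧ 1 < (t - δ) ^ 2 + s} ⊆
      Set.Icc (-Real.sqrt (1 - s)) (-Real.sqrt (1 - s) + δ) := by
    rintro t ⟨h1, h2⟩
    have ha := Real.abs_le_sqrt (show t ^ 2 ≤ 1 - s by linarith)
    have hb := Real.lt_sqrt_of_sq_lt (x := Real.sqrt (1 - s)) (y := (t - δ) ^ 2)
      (by rw [Real.sq_sqrt (by nlinarith)]; linarith)
    rw [Real.sqrt_sq_eq_abs] at hb
    rw [abs_le] at ha
    refine ⟨ha.1, ?_⟩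
    rcases lt_abs.1 hb with h | h <;> linarith
  refine (measure_mono hsub).trans ?_
  rw [Real.volume_Icc]
  simp

lemma volume_ball_diff_shift_basis_le (n : ℕ) (δ : ℝ) (hδ : 0 ≤ δ) :
    volume (closedBall (0 : EuclideanSpace ℝ (Fin (n + 1))) 1 \
      closedBall (δ • EuclideanSpace.single 0 (1 : ℝ)) 1) ≤
      ENNReal.ofReal δ * volume (closedBall (0 : EuclideanSpace ℝ (Fin n)) 1) := by
  set T : Set (ℝ × (Fin n → ℝ)) :=
    {p | p.1 ^ 2 + ∑ i, p.2 i ^ 2 ≤ 1 ∧ 1 < (p.1 - δ) ^ 2 + ∑ i, p.2 i ^ 2} with hT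
  have hTm : MeasurableSet T := by
    have h1 : MeasurableSet {p : ℝ × (Fin n → ℝ) | p.1 ^ 2 + ∑ i, p.2 i ^ 2 ≤ 1} :=
      measurableSet_le (by fun_prop) (by fun_prop)
    have h2 : MeasurableSet {p : ℝ × (Fin n → ℝ) | 1 < (p.1 - δ) ^ 2 + ∑ i, p.2 i ^ 2} :=
      measurableSet_lt (by fun_prop) (by fun_prop)
    exact h1.inter h2
  have hmp := (volume_preserving_piFinSuccAbove (fun _ : Fin (n + 1) => ℝ) 0).comp
    (PiLp.volume_preserving_ofLp (Fin (n + 1)))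
  have hball : closedBall (0 : EuclideanSpace ℝ (Fin n)) 1 =
      WithLp.ofLp ⁻¹' {w : Fin n → ℝ | ∑ i, w i ^ 2 ≤ 1} := by
    ext w
    simp [EuclideanSpace.norm_eq]
  have hset : closedBall (0 : EuclideanSpace ℝ (Fin (n + 1))) 1 \
      closedBall (δ • EuclideanSpace.single 0 (1 : ℝ)) 1 =
      (MeasurableEquiv.piFinSuccAbove (fun _ : Fin (n + 1) => ℝ) 0 ∘ WithLp.ofLp) ⁻¹' T := by
    ext w
    simp [hT, EuclideanSpace.norm_eq, EuclideanSpace.dist_eq, Fin.sum_univ_succ,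
      MeasurableEquiv.piFinSuccAbove, Fin.tail, Real.dist_eq]
  have hBm : MeasurableSet {w : Fin n → ℝ | ∑ i, w i ^ 2 ≤ 1} :=
    measurableSet_le (by fun_prop) (by fun_prop)
  rw [hset, hmp.measure_preimage hTm.nullMeasurableSet, hball,
    (PiLp.volume_preserving_ofLp (Fin n)).measure_preimage hBm.nullMeasurableSet,
    ← lintegral_indicator_const hBm]
  change (Measure.prod volume volume) T ≤ _
  rw [Measure.prod_apply_symm hTm]
  refine lintegral_mono fun w => ?_
  by_cases hw : w ∈ {w : Fin n → ℝ | ∑ i, w i ^ 2 ≤ 1}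
  · rw [Set.indicator_of_mem hw]
    exact volume_shift_interval_diff_le (∑ i, w i ^ 2) δ hδ
  · have : (fun x => (x, w)) ⁻¹' T = ∅ := by
      ext t
      simp only [hT, Set.mem_preimage, Set.mem_ofPred_eq, Set.mem_empty_iff_false, iff_false]
      rintro ⟨h1, -⟩
      exact hw (by have := sq_nonneg t; simp only [Set.mem_ofPred_eq]; linarith)
    rw [this]; simp

lemma volume_ball_diff_shift_le {d : ℕ} (w : EuclideanSpace ℝ (Fin d)) :
    volume (closedBall (0 : EuclideanSpace ℝ (Fin d)) 1 \ closedBall w 1) ≤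
      ENNReal.ofReal (Real.sqrt d * ‖w‖) *
        volume (closedBall (0 : EuclideanSpace ℝ (Fin d)) 1) := by
  rcases eq_or_ne w 0 with rfl | hw
  · simp
  rcases d with _ | n
  · exact absurd (Subsingleton.elim w 0) hw
  have hpos := norm_pos_iff.2 hw
  have ho : Orthonormal ℝ (({0} : Set (Fin (n + 1))).domRestrict
      fun _ : Fin (n + 1) => ‖w‖⁻¹ • w) := by
    refine ⟨fun i => ?_, fun i j hij => absurd (Subsingleton.elim i j) hij⟩
    simp only [Set.domRestrict_apply, norm_smul, norm_inv, norm_norm]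
    exact inv_mul_cancel₀ hpos.ne'
  obtain ⟨b, hb⟩ := ho.exists_orthonormalBasis_extension_of_card_eq (by simp)
  have hb0 : b 0 = ‖w‖⁻¹ • w := hb 0 (by simp)
  have hrepr : b.repr w = ‖w‖ • EuclideanSpace.single 0 (1 : ℝ) := by
    rw [← b.repr_self 0, hb0, ← map_smul, smul_smul, mul_inv_cancel₀ hpos.ne', one_smul]
  have hset : closedBall (0 : EuclideanSpace ℝ (Fin (n + 1))) 1 \ closedBall w 1 =
      b.repr ⁻¹' (closedBall 0 1 \ closedBall (‖w‖ • EuclideanSpace.single 0 (1 : ℝ)) 1) := by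
    rw [← hrepr]
    ext z
    simp only [Set.mem_sdiff, Set.mem_preimage, mem_closedBall, b.repr.dist_map, dist_zero_right,
      b.repr.norm_map]
  rw [hset, b.measurePreserving_repr.measure_preimage
    (measurableSet_closedBall.diff measurableSet_closedBall).nullMeasurableSet]
  refine (volume_ball_diff_shift_basis_le n ‖w‖ hpos.le).trans ?_
  refine (mul_le_mul_right (volume_unit_ball_le_succ n) _).trans_eq ?_
  rw [← mul_assoc, ← ENNReal.ofReal_mul hpos.le, mul_comm ‖w‖]
  push_cast
  rfl

section Pointwise

variable {E : Type*} [NormedAddCommGroup E] [NormedSpace ℝ E]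

lemma le_quadratic_of_fderiv_lipschitz {f : E → ℝ} {s : Set E} {α : ℝ} {x v : E}
    (hf : Differentiable ℝ f) (hs : Convex ℝ s) (hx : x ∈ s) (hv : x + v ∈ s)
    (hL : ∀ y ∈ s, ‖fderiv ℝ f y - fderiv ℝ f x‖ ≤ α * ‖y - x‖) :
    f (x + v) ≤ f x + fderiv ℝ f x v + α / 2 * ‖v‖ ^ 2 := by
  set φ : ℝ → ℝ := fun t => f (x + t • v) - t * fderiv ℝ f x v - α / 2 * ‖v‖ ^ 2 * t ^ 2 with hφ
  have hd : ∀ t, HasDerivAt φ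
      (fderiv ℝ f (x + t • v) v - fderiv ℝ f x v - α * ‖v‖ ^ 2 * t) t := by
    intro t
    have h1 : HasDerivAt (fun t : ℝ => x + t • v) v t := by
      simpa using ((hasDerivAt_id t).smul_const v).const_add x
    have h2 := (hf (x + t • v)).hasFDerivAt.comp_hasDerivAt t h1
    have h3 := (hasDerivAt_id t).mul_const (fderiv ℝ f x v)
    have h4 := (hasDerivAt_pow 2 t).const_mul (α / 2 * ‖v‖ ^ 2)
    refine ((h2.sub h3).sub h4).congr_deriv ?_
    push_cast
    ring
  have hanti : AntitoneOn φ (Set.Icc 0 1) := by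
    refine antitoneOn_of_deriv_nonpos (convex_Icc 0 1)
      (fun t _ => (hd t).continuousAt.continuousWithinAt)
      (fun t _ => (hd t).differentiableAt.differentiableWithinAt) fun t ht => ?_
    rw [interior_Icc] at ht
    rw [(hd t).deriv]
    have hmem : x + t • v ∈ s := hs.add_smul_mem hx hv ⟨ht.1.le, ht.2.le⟩
    have hb := hL _ hmem
    rw [add_sub_cancel_left, norm_smul, Real.norm_of_nonneg ht.1.le] at hb
    have h5 := (le_abs_self _).trans
      ((fderiv ℝ f (x + t • v) - fderiv ℝ f x).le_of_opNorm_le hb v)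
    rw [sub_apply] at h5
    nlinarith
  have := hanti (Set.left_mem_Icc.2 zero_le_one) (Set.right_mem_Icc.2 zero_le_one) zero_le_one
  simp only [hφ, one_smul, zero_smul, add_zero] at this
  linarith

lemma ConvexOn.add_fderiv_le {h : E → ℝ} {s : Set E} (hh : ConvexOn ℝ s h) {x v : E}
    {L : E →L[ℝ] ℝ} (hx : x ∈ s) (hv : x + v ∈ s) (hL : HasFDerivAt h L x) :
    h x + L v ≤ h (x + v) := by
  have hconv := hh.comp_affineMap (AffineMap.lineMap x (x + v))
  have hd : HasDerivAt (h ∘ AffineMap.lineMap x (x + v)) (L v) (0 : ℝ) := by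
    have h1 : HasDerivAt (AffineMap.lineMap x (x + v)) v (0 : ℝ) := by
      simpa using AffineMap.hasDerivAt_lineMap (a := x) (b := x + v) (x := (0 : ℝ))
    exact HasFDerivAt.comp_hasDerivAt (0 : ℝ) (by simpa using hL) h1
  have := hconv.le_slope_of_hasDerivAt (x := 0) (y := 1) (by simpa using hx) (by simpa using hv)
    one_pos hd
  simp [slope_def_field] at this
  linarith

lemma le_two_sqrt_of_forall_mul_le {c α ε R : ℝ} (hR : 0 < R) (hε : 0 ≤ ε) (hα : 0 ≤ α)
    (hεα : ε ≤ α * R ^ 2)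
    (hc : ∀ t, 0 < t → t ≤ 2 * R → c * t ≤ 2 * ε + α / 2 * t ^ 2) :
    c ≤ 2 * Real.sqrt (α * ε) := by
  rcases hε.eq_or_lt with rfl | hε
  · rw [mul_zero, Real.sqrt_zero, mul_zero]
    by_contra! hc0
    have ht : 0 < min (2 * R) (c / (α + 1)) := lt_min (by positivity) (by positivity)
    have h1 := hc _ ht (min_le_left _ _)
    have h2 : min (2 * R) (c / (α + 1)) * (α + 1) ≤ c :=
      (le_div_iff₀ (by positivity)).1 (min_le_right _ _)
    nlinarith
  · have hα : 0 < α := by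
      rcases hα.eq_or_lt with rfl | h
      · linarith
      · exact h
    set a := Real.sqrt α
    set e := Real.sqrt ε
    have ha : 0 < a := Real.sqrt_pos.2 hα
    have he : 0 < e := Real.sqrt_pos.2 hε
    have haa : a ^ 2 = α := Real.sq_sqrt hα.le
    have hee : e ^ 2 = ε := Real.sq_sqrt hε.le
    have heR : e ≤ a * R := by
      rw [← hee, ← haa, ← mul_pow] at hεα
      exact (pow_le_pow_iff_left₀ he.le (by positivity) two_ne_zero).1 hεα
    have h1 := hc (2 * (e / a)) (by positivity) (by
      have : e / a ≤ R := (div_le_iff₀ ha).2 (by linarith)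
      linarith)
    rw [Real.sqrt_mul hα.le]
    rw [← haa, ← hee] at h1
    have h2 : c * (2 * (e / a)) * a ≤ (2 * e ^ 2 + a ^ 2 / 2 * (2 * (e / a)) ^ 2) * a :=
      mul_le_mul_of_nonneg_right h1 ha.le
    have h3 : c * (2 * (e / a)) * a = 2 * e * c := by field_simp
    have h4 : (2 * e ^ 2 + a ^ 2 / 2 * (2 * (e / a)) ^ 2) * a = 2 * e * (2 * (a * e)) := by
      field_simp; ring
    rw [h3, h4] at h2
    exact le_of_mul_le_mul_left h2 (by positivity)

lemma norm_fderiv_sub_le_of_close {R ε α : ℝ} (hR : 0 < R) (hε : 0 ≤ ε) (hα : 0 ≤ α)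
    (hεα : ε ≤ α * R ^ 2) {f h : E → ℝ} (hf : Differentiable ℝ f)
    (hsmooth : ∀ x ∈ closedBall (0 : E) (4 * R), ∀ y ∈ closedBall (0 : E) (4 * R),
      ‖fderiv ℝ f x - fderiv ℝ f y‖ ≤ α * ‖x - y‖)
    (hh : ConvexOn ℝ (closedBall (0 : E) (4 * R)) h)
    (hclose : ∀ x ∈ closedBall (0 : E) (4 * R), |h x - f x| ≤ ε)
    {z : E} (hz : z ∈ closedBall (0 : E) (2 * R)) {L : E →L[ℝ] ℝ} (hL : HasFDerivAt h L z) :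
    ‖L - fderiv ℝ f z‖ ≤ 2 * Real.sqrt (α * ε) := by
  have hz4 : z ∈ closedBall (0 : E) (4 * R) := closedBall_subset_closedBall (by linarith) hz
  have key : ∀ v, (L - fderiv ℝ f z) v ≤ 2 * Real.sqrt (α * ε) * ‖v‖ := by
    intro v
    rcases eq_or_ne v 0 with rfl | hv
    · simp
    have hpos := norm_pos_iff.2 hv
    rw [← div_le_iff₀ hpos]
    refine le_two_sqrt_of_forall_mul_le hR hε hα hεα fun t ht htR => ?_
    set u := (t / ‖v‖) • v
    have hu : ‖u‖ = t := by
      rw [norm_smul, norm_div, norm_norm, Real.norm_of_nonneg ht.le, div_mul_cancel₀ _ hpos.ne']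
    have hzu : z + u ∈ closedBall (0 : E) (4 * R) := by
      rw [mem_closedBall_zero_iff] at hz ⊢
      linarith [norm_add_le z u]
    have h1 := hh.add_fderiv_le hz4 hzu hL
    have h2 := le_quadratic_of_fderiv_lipschitz hf (convex_closedBall _ _) hz4 hzu
      fun y hy => hsmooth y hy z hz4
    have h3 := abs_le.1 (hclose _ hz4)
    have h4 := abs_le.1 (hclose _ hzu)
    have h5 : (L - fderiv ℝ f z) v / ‖v‖ * t = L u - fderiv ℝ f z u := by
      simp only [u, map_smul, sub_apply, smul_eq_mul]
      ring
    rw [h5]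
    rw [hu] at h2
    linarith
  refine ContinuousLinearMap.opNorm_le_bound _ (by positivity) fun v => ?_
  rw [Real.norm_eq_abs, abs_le']
  refine ⟨key v, ?_⟩
  have := key (-v)
  rwa [map_neg, norm_neg] at this

end Pointwise

lemma LipschitzWith.ae_differentiableAt_add_smul {E : Type*} [NormedAddCommGroup E]
    [NormedSpace ℝ E] [FiniteDimensional ℝ E] [MeasurableSpace E] [BorelSpace E]
    (ν : Measure E) [ν.IsAddHaarMeasure] {k : E → ℝ} {K : NNReal} (hk : LipschitzWith K k)
    (x : E) {c : ℝ} (hc : c ≠ 0) : ∀ᵐ u ∂ν, DifferentiableAt ℝ k (x + c • u) := by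
  have hl : LipschitzWith (K * (0 + ‖c‖₊)) fun u => k (x + c • u) :=
    hk.comp ((LipschitzWith.const x).add (lipschitzWith_smul c))
  filter_upwards [hl.ae_differentiableAt (μ := ν)] with u hu
  have he : k = (fun u => k (x + c • u)) ∘ fun z => c⁻¹ • (z - x) := by
    ext z; simp [smul_smul, hc]
  rw [he]
  refine DifferentiableAt.comp _ ?_ (by fun_prop)
  simpa [smul_smul, hc] using hu

lemma norm_setIntegral_sub_shift_le {E F : Type*} [NormedAddCommGroup E]
    [NormedSpace ℝ E] [FiniteDimensional ℝ E] [MeasurableSpace E] [BorelSpace E]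
    [NormedAddCommGroup F] [NormedSpace ℝ F]
    (ν : Measure E) [ν.IsAddHaarMeasure] {φ : E → F} (hφ : LocallyIntegrable φ ν) (w : E) {C : ℝ}
    (hC : ∀ᵐ u ∂ν, u ∈ closedBall (0 : E) 1 → ‖φ u - φ (w - u)‖ ≤ C) :
    ‖(∫ u in closedBall (0 : E) 1, φ u ∂ν) - ∫ u in closedBall (0 : E) 1, φ (u + w) ∂ν‖ ≤
      C * ν.real (closedBall (0 : E) 1 \ closedBall w 1) := by
  have hi : ∀ z : E, IntegrableOn φ (closedBall z 1) ν := fun z =>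
    hφ.integrableOn_isCompact (isCompact_closedBall z 1)
  have hshift : ∫ u in closedBall (0 : E) 1, φ (u + w) ∂ν = ∫ u in closedBall w 1, φ u ∂ν := by
    have hpre : (fun u => u + w) ⁻¹' closedBall w 1 = closedBall 0 1 := by
      ext z; simp [dist_eq_norm]
    rw [← hpre]
    exact (measurePreserving_add_right ν w).setIntegral_preimage_emb
      (measurableEmbedding_addRight w) φ _
  have hpre : (fun u => w - u) ⁻¹' (closedBall w 1 \ closedBall 0 1) =
      closedBall 0 1 \ closedBall w 1 := by
    ext z; simp [dist_eq_norm, norm_sub_rev]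
  have hrefl : ∫ u in closedBall w 1 \ closedBall 0 1, φ u ∂ν =
      ∫ u in closedBall 0 1 \ closedBall w 1, φ (w - u) ∂ν := by
    rw [← hpre]
    exact ((Measure.measurePreserving_sub_left ν w).setIntegral_preimage_emb
      (MeasurableEquiv.subLeft w).measurableEmbedding _ _).symm
  have hi' : IntegrableOn (fun u => φ (w - u)) (closedBall 0 1 \ closedBall w 1) ν := by
    rw [← hpre]
    exact ((Measure.measurePreserving_sub_left ν w).integrableOn_comp_preimage
      (MeasurableEquiv.subLeft w).measurableEmbedding).2 ((hi w).mono_set Set.sdiff_subset)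
  rw [hshift, ← integral_inter_add_sdiff (measurableSet_closedBall (x := w)) (hi 0),
    ← integral_inter_add_sdiff (measurableSet_closedBall (x := (0 : E))) (hi w),
    Set.inter_comm (closedBall w 1), add_sub_add_left_eq_sub, hrefl,
    ← integral_sub ((hi 0).mono_set Set.sdiff_subset) hi']
  refine norm_setIntegral_le_of_norm_le_const_ae'
    ((measure_mono Set.sdiff_subset).trans_lt measure_closedBall_lt_top) ?_
  filter_upwards [hC] with u hu hmem using hu hmem.1

lemma norm_setAverage_sub_shift_le {d : ℕ} {F : Type*} [NormedAddCommGroup F] [NormedSpace ℝ F]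
    {φ : EuclideanSpace ℝ (Fin d) → F} (hφ : LocallyIntegrable φ) (w : EuclideanSpace ℝ (Fin d))
    {a b : ℝ} (ha : 0 ≤ a) (hb : 0 ≤ b)
    (hrefl : ∀ᵐ u, u ∈ closedBall (0 : EuclideanSpace ℝ (Fin d)) 1 →
      ‖φ u - φ (w - u)‖ ≤ a + b * (2 + ‖w‖))
    (htrans : ∀ᵐ u, u ∈ closedBall (0 : EuclideanSpace ℝ (Fin d)) 1 →
      ‖φ u - φ (u + w)‖ ≤ a + b * ‖w‖) :
    ‖(⨍ u in closedBall (0 : EuclideanSpace ℝ (Fin d)) 1, φ u) -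
      ⨍ u in closedBall (0 : EuclideanSpace ℝ (Fin d)) 1, φ (u + w)‖ ≤
      (a + 3 * b) * Real.sqrt d * ‖w‖ := by
  set B := closedBall (0 : EuclideanSpace ℝ (Fin d)) 1 with hB
  have hV : 0 < volume.real B :=
    ENNReal.toReal_pos (measure_closedBall_pos _ _ one_pos).ne' measure_closedBall_lt_top.ne
  have hfin : volume B ≠ ⊤ := measure_closedBall_lt_top.ne
  rw [setAverage_eq, setAverage_eq, ← smul_sub, norm_smul, Real.norm_of_nonneg (by positivity),
    inv_mul_le_iff₀ hV]
  rcases eq_or_ne w 0 with rfl | hw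
  · simp
  rcases le_total ‖w‖ 1 with h1 | h1
  · have hvol : volume.real (B \ closedBall w 1) ≤ Real.sqrt d * ‖w‖ * volume.real B := by
      have := ENNReal.toReal_mono (by finiteness) (volume_ball_diff_shift_le w)
      rwa [ENNReal.toReal_mul, ENNReal.toReal_ofReal (by positivity)] at this
    refine (norm_setIntegral_sub_shift_le volume hφ w hrefl).trans ?_
    calc _ ≤ (a + b * (2 + 1)) * (Real.sqrt d * ‖w‖ * volume.real B) := by gcongr
      _ = _ := by ring
  · have hd : 1 ≤ Real.sqrt d := by
      rw [Real.one_le_sqrt]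
      rcases d with _ | n
      · exact absurd (Subsingleton.elim w 0) hw
      · push_cast; linarith [(Nat.cast_nonneg n : (0 : ℝ) ≤ n)]
    have hpre : (fun u => u + w) ⁻¹' closedBall w 1 = B := by
      ext z; simp [hB, dist_eq_norm]
    have hi' : IntegrableOn (fun u => φ (u + w)) B := by
      rw [← hpre]
      exact ((measurePreserving_add_right volume w).integrableOn_comp_preimage
        (measurableEmbedding_addRight w)).2
        (hφ.integrableOn_isCompact (isCompact_closedBall w 1))
    rw [← integral_sub (hφ.integrableOn_isCompact (isCompact_closedBall _ _)) hi']
    refine (norm_setIntegral_le_of_norm_le_const_ae' measure_closedBall_lt_top htrans).trans ?_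
    rw [mul_comm]
    gcongr
    have h2 : 1 ≤ Real.sqrt d * ‖w‖ := one_le_mul_of_one_le_of_one_le hd h1
    have h3 : a ≤ a * (Real.sqrt d * ‖w‖) := le_mul_of_one_le_right ha h2
    have h4 : b * ‖w‖ ≤ b * (Real.sqrt d * ‖w‖) := by
      gcongr; exact le_mul_of_one_le_left (norm_nonneg _) hd
    have h5 : 0 ≤ b * (Real.sqrt d * ‖w‖) := by positivity
    linarith

theorem stmt6 {d : ℕ} (R ε α r : ℝ) (hR : 0 < R) (hε : 0 ≤ ε) (hα : 0 ≤ α)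
    (hεα : ε ≤ α * R ^ 2) (hr0 : 0 < r) (hrR : r ≤ R)
    (f h : EuclideanSpace ℝ (Fin d) → ℝ)
    (hfconv : ConvexOn ℝ (closedBall (0 : EuclideanSpace ℝ (Fin d)) (4 * R)) f)
    (hfdiff : Differentiable ℝ f)
    (hsmooth : ∀ x ∈ closedBall (0 : EuclideanSpace ℝ (Fin d)) (4 * R),
      ∀ y ∈ closedBall (0 : EuclideanSpace ℝ (Fin d)) (4 * R),
        ‖gradient f x - gradient f y‖ ≤ α * ‖x - y‖)
    (hhconv : ConvexOn ℝ (closedBall (0 : EuclideanSpace ℝ (Fin d)) (4 * R)) h)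
    (hclose : ∀ x ∈ closedBall (0 : EuclideanSpace ℝ (Fin d)) (4 * R), |h x - f x| ≤ ε)
    (μ : Measure (EuclideanSpace ℝ (Fin d)))
    (hμ : μ = (volume (closedBall (0 : EuclideanSpace ℝ (Fin d)) 1))⁻¹ •
      volume.restrict (closedBall (0 : EuclideanSpace ℝ (Fin d)) 1))
    (hr : EuclideanSpace ℝ (Fin d) → ℝ)
    (hhr : ∀ x, hr x = ∫ u, h (x + r • u) ∂μ) :
    (∀ x ∈ closedBall (0 : EuclideanSpace ℝ (Fin d)) R, DifferentiableAt ℝ hr x) ∧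
    (∀ x ∈ closedBall (0 : EuclideanSpace ℝ (Fin d)) R,
      ∀ y ∈ closedBall (0 : EuclideanSpace ℝ (Fin d)) R,
        ‖gradient hr x - gradient hr y‖ ≤
          (4 * Real.sqrt (α * ε * d) / r + 3 * α * Real.sqrt d) * ‖x - y‖) := by
  have hgrad : ∀ (g : EuclideanSpace ℝ (Fin d) → ℝ) x y,
      ‖gradient g x - gradient g y‖ = ‖fderiv ℝ g x - fderiv ℝ g y‖ := fun g x y => by
    rw [gradient, gradient, ← map_sub, LinearIsometryEquiv.norm_map]
  simp only [hgrad] at hsmooth ⊢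
  obtain ⟨K, hK⟩ : ∃ K, LipschitzOnWith K h (ball 0 (3 * R)) := by
    have hball := hhconv.subset ball_subset_closedBall (convex_ball _ _)
    refine hball.exists_lipschitzOnWith_of_isBounded (by linarith : 3 * R < 4 * R) ?_
    obtain ⟨M, hM⟩ := (isCompact_closedBall (0 : EuclideanSpace ℝ (Fin d))
      (4 * R)).exists_bound_of_continuousOn hfdiff.continuous.continuousOn
    refine isBounded_iff_forall_norm_le.2 ⟨ε + M, ?_⟩
    rintro _ ⟨z, hz, rfl⟩
    have hz := ball_subset_closedBall hz
    calc ‖h z‖ = ‖(h z - f z) + f z‖ := by rw [sub_add_cancel]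
      _ ≤ ‖h z - f z‖ + ‖f z‖ := norm_add_le _ _
      _ ≤ _ := add_le_add (hclose z hz) (hM z hz)
  obtain ⟨k, hk, hkh⟩ := hK.extend_real
  have hsub : ∀ {x u : EuclideanSpace ℝ (Fin d)} {ρ : ℝ}, ‖x‖ ≤ ρ → ‖u‖ ≤ 1 →
      ‖x + r • u‖ ≤ ρ + R := fun {x u ρ} hx hu => by
    refine (norm_add_le _ _).trans (add_le_add hx ?_)
    rw [norm_smul, Real.norm_of_nonneg hr0.le]
    nlinarith [norm_nonneg u]
  have hpt : ∀ {z z'}, z ∈ closedBall (0 : EuclideanSpace ℝ (Fin d)) (2 * R) →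
      z' ∈ closedBall (0 : EuclideanSpace ℝ (Fin d)) (2 * R) → DifferentiableAt ℝ k z →
      DifferentiableAt ℝ k z' →
      ‖fderiv ℝ k z - fderiv ℝ k z'‖ ≤ 4 * Real.sqrt (α * ε) + α * ‖z - z'‖ := by
    have hnear : ∀ {z}, z ∈ closedBall (0 : EuclideanSpace ℝ (Fin d)) (2 * R) →
        DifferentiableAt ℝ k z → ‖fderiv ℝ k z - fderiv ℝ f z‖ ≤ 2 * Real.sqrt (α * ε) := by
      intro z hz hkz
      refine norm_fderiv_sub_le_of_close hR hε hα hεα hfdiff hsmooth hhconv hclose hz ?_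
      refine hkz.hasFDerivAt.congr_of_eventuallyEq ?_
      filter_upwards [isOpen_ball.mem_nhds (closedBall_subset_ball (by linarith) hz :
        z ∈ ball 0 (3 * R))] with y hy using hkh hy
    intro z z' hz hz' hkz hkz'
    have h1 := hnear hz hkz
    have h2 := hnear hz' hkz'
    have h3 := hsmooth z (closedBall_subset_closedBall (by linarith) hz) z'
      (closedBall_subset_closedBall (by linarith) hz')
    rw [← norm_neg, neg_sub] at h2
    have e : fderiv ℝ k z - fderiv ℝ k z' = (fderiv ℝ k z - fderiv ℝ f z) +
      (fderiv ℝ f z - fderiv ℝ f z') + (fderiv ℝ f z' - fderiv ℝ k z') := by abel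
    rw [e]
    linarith [norm_add₃_le (a := fderiv ℝ k z - fderiv ℝ f z)
      (b := fderiv ℝ f z - fderiv ℝ f z') (c := fderiv ℝ f z' - fderiv ℝ k z')]
  have hμavg : μ = (volume.restrict (closedBall (0 : EuclideanSpace ℝ (Fin d)) 1) Set.univ)⁻¹ •
      volume.restrict (closedBall (0 : EuclideanSpace ℝ (Fin d)) 1) := by
    rw [hμ, Measure.restrict_apply_univ]
  have hac : μ ≪ volume := by
    rw [hμ]
    exact (Measure.smul_absolutelyContinuous).trans Measure.absolutelyContinuous_restrict
  have hμB : ∀ᵐ u ∂μ, ‖u‖ ≤ 1 := by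
    rw [hμ]
    refine Measure.smul_absolutelyContinuous.ae_le ?_
    filter_upwards [ae_restrict_mem measurableSet_closedBall] with u hu
    simpa using hu
  have hμfin : IsFiniteMeasure μ := by
    rw [hμ]
    have : IsFiniteMeasure
        (volume.restrict (closedBall (0 : EuclideanSpace ℝ (Fin d)) 1)) :=
      isFiniteMeasure_restrict.2 measure_closedBall_lt_top.ne
    exact Measure.smul_finite _ (ENNReal.inv_ne_top.2 (measure_closedBall_pos _ _ one_pos).ne')
  have hmeas : StronglyMeasurable (fderiv ℝ k) := (measurable_fderiv ℝ k).stronglyMeasurable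
  have hderiv : ∀ x ∈ closedBall (0 : EuclideanSpace ℝ (Fin d)) R,
      HasFDerivAt hr (∫ u, fderiv ℝ k (x + r • u) ∂μ) x := by
    intro x hx
    have hkc := hk.continuous
    have hint : HasFDerivAt (fun x => ∫ u, k (x + r • u) ∂μ)
        (∫ u, fderiv ℝ k (x + r • u) ∂μ) x := by
      refine (hasFDerivAt_integral_of_dominated_loc_of_lip (bound := fun _ => K) Filter.univ_mem
        (.of_forall fun x => ?_) ?_ ?_ ?_ (integrable_const _) ?_).2
      · exact (by fun_prop : Continuous fun u => k (x + r • u)).aestronglyMeasurable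
      · obtain ⟨M, hM⟩ := (isCompact_closedBall (0 : EuclideanSpace ℝ (Fin d))
          1).exists_bound_of_continuousOn
          (by fun_prop : Continuous fun u => k (x + r • u)).continuousOn
        refine .of_bound
          (by fun_prop : Continuous fun u => k (x + r • u)).aestronglyMeasurable M ?_
        filter_upwards [hμB] with u hu using hM u (by simpa using hu)
      · exact (hmeas.comp_measurable (by fun_prop)).aestronglyMeasurable
      · refine .of_forall fun u => ?_
        rw [lipschitzOnWith_univ]
        have : LipschitzWith (K * (1 + 0)) fun x => k (x + r • u) :=
          hk.comp (LipschitzWith.id.add (LipschitzWith.const _))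
        simpa using this
      · filter_upwards [hac.ae_le (hk.ae_differentiableAt_add_smul volume x hr0.ne')] with u hu
        exact (hasFDerivAt_comp_add_right (r • u)).2 hu.hasFDerivAt
    refine hint.congr_of_eventuallyEq ?_
    filter_upwards [isOpen_ball.mem_nhds (closedBall_subset_ball (by linarith) hx :
        x ∈ ball 0 (2 * R))] with y hy
    rw [hhr]
    refine integral_congr_ae ?_
    filter_upwards [hμB] with u hu
    apply hkh
    rw [mem_ball_zero_iff] at hy ⊢
    refine (norm_add_le _ _).trans_lt ?_
    rw [norm_smul, Real.norm_of_nonneg hr0.le]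
    nlinarith [norm_nonneg u]
  refine ⟨fun x hx => (hderiv x hx).differentiableAt, fun x hx y hy => ?_⟩
  rw [(hderiv x hx).fderiv, (hderiv y hy).fderiv]
  set w := r⁻¹ • (y - x) with hw
  have hrw : r • w = y - x := by rw [hw, smul_smul, mul_inv_cancel₀ hr0.ne', one_smul]
  have hwn : r * ‖w‖ = ‖x - y‖ := by
    rw [norm_sub_rev x y, ← hrw, norm_smul r w, Real.norm_of_nonneg hr0.le]
  have hφ : LocallyIntegrable (fun u => fderiv ℝ k (x + r • u)) := by
    refine (locallyIntegrable_const (K : ℝ)).mono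
      (hmeas.comp_measurable (by fun_prop)).aestronglyMeasurable (.of_forall fun u => ?_)
    simpa using norm_fderiv_le_of_lipschitz ℝ hk
  have hdx := hk.ae_differentiableAt_add_smul volume x hr0.ne'
  have hshift : ∀ u, x + r • (u + w) = y + r • u := fun u => by rw [smul_add, hrw]; abel
  have hflip : ∀ u, x + r • (w - u) = y + r • -u := fun u => by
    rw [smul_sub, hrw, smul_neg]; abel
  rw [mem_closedBall_zero_iff] at hx hy
  have main := norm_setAverage_sub_shift_le hφ w (a := 4 * Real.sqrt (α * ε)) (b := α * r)
    (by positivity) (by positivity) (by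
      filter_upwards [hdx, hk.ae_differentiableAt_add_smul volume y (neg_ne_zero.2 hr0.ne')]
        with u h1 h2 hu
      rw [neg_smul, ← smul_neg] at h2
      rw [mem_closedBall_zero_iff] at hu
      rw [hflip]
      refine (hpt (by simpa [two_mul] using hsub hx hu)
        (by rw [mem_closedBall_zero_iff, two_mul]; exact hsub hy (by rwa [norm_neg]))
        h1 h2).trans ?_
      rw [mul_assoc]
      gcongr
      have e : x + r • u - (y + r • -u) = (x - y) + (2 : ℝ) • r • u := by
        rw [two_smul, smul_neg]; abel
      rw [e, mul_add, hwn]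
      refine (norm_add_le _ _).trans ?_
      rw [norm_smul, norm_smul, Real.norm_of_nonneg hr0.le, Real.norm_two]
      nlinarith) (by
      filter_upwards [hdx, hk.ae_differentiableAt_add_smul volume y hr0.ne'] with u h1 h2 hu
      rw [mem_closedBall_zero_iff] at hu
      rw [hshift]
      refine (hpt (by simpa [two_mul] using hsub hx hu) (by simpa [two_mul] using hsub hy hu)
        h1 h2).trans ?_
      rw [mul_assoc, hwn, add_sub_add_right_eq_sub])
  simp only [hshift] at main
  rw [average, average, ← hμavg] at main
  refine main.trans_eq ?_
  rw [Real.sqrt_mul (by positivity) (d : ℝ), ← hwn]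
  field_simp
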